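/- Let M = (M,<,…) be an almost o-minimal structure, let D ⊆ M be a definable discrete set, let a < b in M, and let n ≥ 1. Then for every definable function F : (a,b)ⁿ → D, the range of F is a bounded subset of M (bounded both above and below). -/

import Mathlib

open FirstOrder FirstOrder.Language

universe u v w x

/-- A subset of a linear order is an open interval (possibly unbounded). -/
def IsOpenIntervalSet {M : Type w} [LinearOrder M] (s : Set M) : Prop :=
  (∃ a b : M, s = Set.Ioo a b) ∨ (∃ a : M, s = Set.Ioi a) ∨ (∃ b : M, s = Set.Iio b) ∨
    s = Set.univ

/-- `s` is a finite union of points and open intervals. -/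
def IsFinUnionPointsIntervals {M : Type w} [LinearOrder M] (s : Set M) : Prop :=
  ∃ (F : Finset M) (n : ℕ) (J : Fin n → Set M),
    (∀ k, IsOpenIntervalSet (J k)) ∧ s = ↑F ∪ ⋃ k, J k

/-- `M` is o-minimal: every subset of `M` definable with parameters is a finite union of
points and open intervals. -/
def IsOMinimal (L : FirstOrder.Language.{u, v}) (M : Type w) [L.Structure M]
    [LinearOrder M] : Prop :=
  ∀ s : Set M, (Set.univ : Set M).Definable₁ L s → IsFinUnionPointsIntervals s

/-- `M` is almost o-minimal: every bounded definable (with parameters) subset of `M` is a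
finite union of points and open intervals. -/
def IsAlmostOMinimal (L : FirstOrder.Language.{u, v}) (M : Type w) [L.Structure M]
    [LinearOrder M] : Prop :=
  ∀ s : Set M, (Set.univ : Set M).Definable₁ L s → BddAbove s → BddBelow s →
    IsFinUnionPointsIntervals s

/-- `M` is downward o-minimal: every definable (with parameters) subset of `M` that is
bounded above is a finite union of points and open intervals. -/
def IsDownwardOMinimal (L : FirstOrder.Language.{u, v}) (M : Type w) [L.Structure M]
    [LinearOrder M] : Prop :=
  ∀ s : Set M, (Set.univ : Set M).Definable₁ L s → BddAbove s → IsFinUnionPointsIntervals s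

/-- `M` is upward o-minimal: every definable (with parameters) subset of `M` that is
bounded below is a finite union of points and open intervals. -/
def IsUpwardOMinimal (L : FirstOrder.Language.{u, v}) (M : Type w) [L.Structure M]
    [LinearOrder M] : Prop :=
  ∀ s : Set M, (Set.univ : Set M).Definable₁ L s → BddBelow s → IsFinUnionPointsIntervals s

/-- A subset `D` of a linear order is discrete if every point of `D` has an open interval
around it containing no other point of `D`. -/
def IsDiscreteSet {M : Type w} [LinearOrder M] (D : Set M) : Prop :=
  ∀ x ∈ D, ∃ l r : M, l < x ∧ x < r ∧ ∀ z ∈ D, z ∈ Set.Ioo l r → z = x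

/-! ### Definable predicates -/

section DefinablePred

variable {L : FirstOrder.Language.{u, v}} {M : Type w} [L.Structure M] {n m : ℕ}

/-- A predicate on `n`-tuples is definable (with parameters) if its truth set is. -/
def DefinablePred (L : FirstOrder.Language.{u, v}) {M : Type w} [L.Structure M] {n : ℕ}
    (P : (Fin n → M) → Prop) : Prop :=
  (Set.univ : Set M).Definable L {v | P v}

namespace DefinablePred

variable {P Q : (Fin n → M) → Prop}

theorem and (hP : DefinablePred L P) (hQ : DefinablePred L Q) :
    DefinablePred L fun v => P v ∧ Q v :=
  hP.inter hQ

theorem not (hP : DefinablePred L P) : DefinablePred L fun v => ¬ P v :=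
  hP.compl

theorem imp (hP : DefinablePred L P) (hQ : DefinablePred L Q) :
    DefinablePred L fun v => P v → Q v := by
  simpa only [not_and_not_right] using (hP.and hQ.not).not

theorem comp (hP : DefinablePred L P) (f : Fin n → Fin m) :
    DefinablePred L fun v : Fin m → M => P fun i => v (f i) :=
  Set.Definable.preimage_comp f hP

theorem exists_comp_eq {R : (Fin m → M) → Prop} (hR : DefinablePred L R) (f : Fin n → Fin m) :
    DefinablePred L fun v : Fin n → M => ∃ w, R w ∧ (fun i => w (f i)) = v :=
  Set.Definable.image_comp hR f

theorem ex {R : (Fin n → M) → M → Prop}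
    (hR : DefinablePred L fun w : Fin (n + 1) → M => R (fun i => w i.succ) (w 0)) :
    DefinablePred L fun v => ∃ x, R v x := by
  convert! hR.exists_comp_eq Fin.succ using 2 with v
  constructor
  · rintro ⟨x, hx⟩
    exact ⟨Fin.cons x v, by simpa using hx, by simp⟩
  · rintro ⟨w, hw, rfl⟩
    exact ⟨w 0, hw⟩

theorem all {R : (Fin n → M) → M → Prop}
    (hR : DefinablePred L fun w : Fin (n + 1) → M => R (fun i => w i.succ) (w 0)) :
    DefinablePred L fun v => ∀ x, R v x := by
  simpa only [not_exists, not_not] using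
    (DefinablePred.ex (R := fun v x => ¬ R v x) hR.not).not

theorem all_fin {R : Fin m → (Fin n → M) → Prop} (hR : ∀ i, DefinablePred L (R i)) :
    DefinablePred L fun v => ∀ i, R i v := by
  have h := Set.definable_iInter_of_finite hR
  rwa [← Set.ofPred_forall] at h

theorem of_definable₁ {s : Set M} (hs : (Set.univ : Set M).Definable₁ L s) (i : Fin n) :
    DefinablePred L fun v => v i ∈ s :=
  DefinablePred.comp (P := fun v : Fin 1 → M => v 0 ∈ s) hs fun _ => i

theorem rel {R : M → M → Prop} (hR : DefinablePred L fun v : Fin 2 → M => R (v 0) (v 1))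
    (i j : Fin n) : DefinablePred L fun v => R (v i) (v j) :=
  hR.comp ![i, j]

theorem eq_const (c : M) (i : Fin n) : DefinablePred L fun v => v i = c :=
  ⟨(FirstOrder.Language.Term.var i).equal (L.con (⟨c, Set.mem_univ c⟩ : (Set.univ : Set M))).term, by
    ext v; simp⟩

/-- All variables but the first two may be replaced by parameters. -/
theorem specialize {R : (Fin 2 → M) → (Fin n → M) → Prop}
    (hR : DefinablePred L fun w : Fin (n + 2) → M => R ![w 0, w 1] fun i => w i.succ.succ)
    (y : Fin n → M) : DefinablePred L fun v => R v y := by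
  convert! (hR.and (all_fin fun i => eq_const (L := L) (y i) (i.succ.succ : Fin (n + 2)))
    ).exists_comp_eq ![0, 1] using 2 with v
  constructor
  · intro h
    refine ⟨Fin.cons (v 0) (Fin.cons (v 1) y), ⟨?_, fun i => by simp⟩, ?_⟩
    · convert! h using 1
      ext i; fin_cases i <;> rfl
    · ext i; fin_cases i <;> rfl
  · rintro ⟨w, ⟨h, hy⟩, rfl⟩
    convert! h using 1
    · ext i; fin_cases i <;> rfl
    · ext i; exact (hy i).symm

end DefinablePred

end DefinablePred

/-! ### Finite unions of points and intervals -/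

section Intervals

variable {M : Type w} [LinearOrder M]

theorem IsFinUnionPointsIntervals.induction {p : Set M → Prop} {s : Set M}
    (hs : IsFinUnionPointsIntervals s) (empty : p ∅) (singleton : ∀ x, p {x})
    (interval : ∀ J, IsOpenIntervalSet J → p J) (union : ∀ A B, p A → p B → p (A ∪ B)) :
    p s := by
  classical
  obtain ⟨F, n, J, hJ, rfl⟩ := hs
  apply union
  · induction F using Finset.induction_on with
    | empty => simpa using empty
    | insert x F _ ih =>
      rw [Finset.coe_insert, Set.insert_eq]
      exact union _ _ (singleton x) ih
  · induction n with
    | zero => simpa using empty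
    | succ n ih =>
      have : (⋃ k, J k) = J 0 ∪ ⋃ k : Fin n, J k.succ := by
        ext x; simp [Fin.exists_fin_succ]
      rw [this]
      exact union _ _ (interval _ (hJ 0)) (ih _ fun k => hJ _)

theorem IsFinUnionPointsIntervals.finite_or_exists_Ioo_subset [NoMinOrder M] [NoMaxOrder M]
    {s : Set M} (hs : IsFinUnionPointsIntervals s) : s.Finite ∨ ∃ p q, p < q ∧ Set.Ioo p q ⊆ s := by
  refine hs.induction (p := fun s => s.Finite ∨ ∃ p q, p < q ∧ Set.Ioo p q ⊆ s)
    (.inl Set.finite_empty) (fun x => .inl (Set.finite_singleton x)) ?_ ?_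
  · rintro J (⟨c, d, rfl⟩ | ⟨c, rfl⟩ | ⟨d, rfl⟩ | rfl)
    · rcases lt_or_ge c d with h | h
      · exact .inr ⟨c, d, h, subset_rfl⟩
      · exact .inl (by simp [Set.Ioo_eq_empty h.not_gt])
    · obtain ⟨d, hd⟩ := exists_gt c
      exact .inr ⟨c, d, hd, fun x hx => hx.1⟩
    · obtain ⟨c, hc⟩ := exists_lt d
      exact .inr ⟨c, d, hc, fun x hx => hx.2⟩
    · rcases isEmpty_or_nonempty M with h | ⟨⟨c⟩⟩
      · exact .inl (Set.toFinite _)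
      · obtain ⟨d, hd⟩ := exists_gt c
        exact .inr ⟨c, d, hd, Set.subset_univ _⟩
  · rintro A B (hA | ⟨p, q, h, hA⟩) (hB | ⟨p', q', h', hB⟩)
    · exact .inl (hA.union hB)
    · exact .inr ⟨p', q', h', hB.trans Set.subset_union_right⟩
    all_goals exact .inr ⟨p, q, h, hA.trans Set.subset_union_left⟩

/-- Membership in a finite union of points and intervals is constant just to the right of
every point. -/
theorem IsFinUnionPointsIntervals.exists_Ioo_right [NoMaxOrder M] {s : Set M}
    (hs : IsFinUnionPointsIntervals s) (x : M) :
    ∃ y, x < y ∧ ((∀ z, x < z → z < y → z ∈ s) ∨ ∀ z, x < z → z < y → z ∉ s) := by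
  obtain ⟨t, ht⟩ := exists_gt x
  refine hs.induction (p := fun s => ∃ y, x < y ∧
    ((∀ z, x < z → z < y → z ∈ s) ∨ ∀ z, x < z → z < y → z ∉ s)) ⟨t, ht, .inr fun _ _ _ => id⟩ (fun c => ?_) ?_ ?_
  · rcases lt_or_ge x c with h | h
    · exact ⟨c, h, .inr fun z _ hz => hz.ne⟩
    · exact ⟨t, ht, .inr fun z hz _ => (h.trans_lt hz).ne'⟩
  · rintro J (⟨c, d, rfl⟩ | ⟨c, rfl⟩ | ⟨d, rfl⟩ | rfl)
    · rcases lt_or_ge x c with h | h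
      · exact ⟨c, h, .inr fun z _ hz hz' => hz.not_gt hz'.1⟩
      · rcases lt_or_ge x d with h' | h'
        · exact ⟨d, h', .inl fun z hz hz' => ⟨h.trans_lt hz, hz'⟩⟩
        · exact ⟨t, ht, .inr fun z hz _ hz' => (h'.trans_lt hz).not_gt hz'.2⟩
    · rcases lt_or_ge x c with h | h
      · exact ⟨c, h, .inr fun z _ hz hz' => hz.not_gt hz'⟩
      · exact ⟨t, ht, .inl fun z hz _ => h.trans_lt hz⟩
    · rcases lt_or_ge x d with h | h
      · exact ⟨d, h, .inl fun z _ hz => hz⟩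
      · exact ⟨t, ht, .inr fun z hz _ hz' => (h.trans_lt hz).not_gt hz'⟩
    · exact ⟨t, ht, .inl fun z _ _ => Set.mem_univ z⟩
  · rintro A B ⟨y, hy, hA⟩ ⟨y', hy', hB⟩
    refine ⟨min y y', lt_min hy hy', ?_⟩
    simp only [lt_min_iff, Set.mem_union]
    rcases hA with hA | hA
    · exact .inl fun z hz hz' => .inl (hA z hz hz'.1)
    · rcases hB with hB | hB
      · exact .inl fun z hz hz' => .inr (hB z hz hz'.2)
      · exact .inr fun z hz hz' h => h.elim (hA z hz hz'.1) (hB z hz hz'.2)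

theorem IsFinUnionPointsIntervals.exists_isGLB [DenselyOrdered M] [NoMinOrder M] [NoMaxOrder M]
    {s : Set M} (hs : IsFinUnionPointsIntervals s) (hne : s.Nonempty) (hbdd : BddBelow s) :
    ∃ x, IsGLB s x := by
  have key : s = ∅ ∨ ¬ BddBelow s ∨ ∃ x, IsGLB s x := by
    refine hs.induction (p := fun s => s = ∅ ∨ ¬ BddBelow s ∨ ∃ x, IsGLB s x) (.inl rfl) (fun x => .inr (.inr ⟨x, isGLB_singleton⟩)) ?_ ?_
    · rintro J (⟨c, d, rfl⟩ | ⟨c, rfl⟩ | ⟨d, rfl⟩ | rfl)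
      · rcases lt_or_ge c d with h | h
        · exact .inr (.inr ⟨c, isGLB_Ioo h⟩)
        · exact .inl (Set.Ioo_eq_empty h.not_gt)
      · exact .inr (.inr ⟨c, isGLB_Ioi⟩)
      · exact .inr (.inl (not_bddBelow_Iio d))
      · rcases isEmpty_or_nonempty M with h | h
        · exact .inl (Set.univ_eq_empty_iff.2 h)
        · exact .inr (.inl not_bddBelow_univ)
    · rintro A B (rfl | hA | ⟨x, hA⟩) hB
      · simpa using hB
      · exact .inr (.inl fun h => hA (h.mono Set.subset_union_left))
      · rcases hB with rfl | hB | ⟨y, hB⟩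
        · exact .inr (.inr ⟨x, by simpa using hA⟩)
        · exact .inr (.inl fun h => hB (h.mono Set.subset_union_right))
        · exact .inr (.inr ⟨_, hA.union hB⟩)
  rcases key with h | h | h
  · exact absurd h hne.ne_empty
  · exact absurd hbdd h
  · exact h

end Intervals

/-! ### Definable functions into discrete sets -/

section AlmostOMinimal

variable {L : FirstOrder.Language.{u, v}} {M : Type w} [LinearOrder M] [L.Structure M]

theorem DefinablePred.const_le (hle : DefinablePred L fun v : Fin 2 → M => v 0 ≤ v 1) {n : ℕ}
    (c : M) (i : Fin n) : DefinablePred L fun v : Fin n → M => c ≤ v i := by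
  have : DefinablePred L fun v : Fin n → M => ∃ x, x = c ∧ x ≤ v i :=
    .ex (.and (.eq_const c 0) (.rel hle 0 i.succ))
  simpa using this

theorem DefinablePred.le_const (hle : DefinablePred L fun v : Fin 2 → M => v 0 ≤ v 1) {n : ℕ}
    (c : M) (i : Fin n) : DefinablePred L fun v : Fin n → M => v i ≤ c := by
  have : DefinablePred L fun v : Fin n → M => ∃ x, x = c ∧ v i ≤ x :=
    .ex (.and (.eq_const c 0) (.rel hle i.succ 0))
  simpa using this

theorem IsDiscreteSet.not_Ioo_subset [DenselyOrdered M] {D : Set M} (hD : IsDiscreteSet D) {p q : M}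
    (hpq : p < q) : ¬ Set.Ioo p q ⊆ D := by
  intro h
  obtain ⟨x, hpx, hxq⟩ := exists_between hpq
  obtain ⟨l, r, hl, hr, hlr⟩ := hD x (h ⟨hpx, hxq⟩)
  obtain ⟨z, hxz, hz⟩ := exists_between (lt_min hxq hr)
  rw [lt_min_iff] at hz
  exact hxz.ne' (hlr z (h ⟨hpx.trans hxz, hz.1⟩) ⟨hl.trans hxz, hz.2⟩)

variable [DenselyOrdered M] [NoMinOrder M] [NoMaxOrder M]

theorem IsAlmostOMinimal.finite_inter_Icc (halmost : IsAlmostOMinimal L M)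
    (hle : DefinablePred L fun v : Fin 2 → M => v 0 ≤ v 1) {D : Set M}
    (hDdef : (Set.univ : Set M).Definable₁ L D) (hDdisc : IsDiscreteSet D) (c d : M) :
    {x | x ∈ D ∧ c ≤ x ∧ x ≤ d}.Finite := by
  have hdef : (Set.univ : Set M).Definable₁ L {x | x ∈ D ∧ c ≤ x ∧ x ≤ d} :=
    (DefinablePred.of_definable₁ hDdef 0).and ((DefinablePred.const_le hle c 0).and
      (DefinablePred.le_const hle d 0))
  rcases (halmost _ hdef ⟨d, fun x hx => hx.2.2⟩
    ⟨c, fun x hx => hx.2.1⟩).finite_or_exists_Ioo_subset with h | ⟨p, q, hpq, h⟩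
  · exact h
  · exact absurd (fun x hx => (h hx).1) (hDdisc.not_Ioo_subset hpq)

/-- A bounded definable set that is the increasing union of a definable family of finite sets
is finite. -/
theorem IsAlmostOMinimal.finite_of_finite_initial (halmost : IsAlmostOMinimal L M)
    (hle : DefinablePred L fun v : Fin 2 → M => v 0 ≤ v 1) {G : M → M → Prop}
    (hG : DefinablePred L fun v : Fin 2 → M => G (v 0) (v 1))
    (hfin : ∀ d, {x | ∃ e ≤ d, G e x}.Finite)
    (habove : BddAbove {x | ∃ e, G e x}) (hbelow : BddBelow {x | ∃ e, G e x}) :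
    {x | ∃ e, G e x}.Finite := by
  have hT : (Set.univ : Set M).Definable₁ L {x | ∃ e, G e x} :=
    DefinablePred.ex (n := 1) (R := fun v e => G e (v 0)) (hG.rel 0 1)
  rcases (halmost _ hT habove hbelow).finite_or_exists_Ioo_subset with h | ⟨p, q, hpq, hsub⟩
  · exact h
  exfalso
  set R : Set M := {t | (¬ t ≤ p ∧ ¬ q ≤ t) ∧ ∃ d, G d t ∧
    ∀ e x, e ≤ d → G e x → ¬ x ≤ p ∧ ¬ q ≤ x → t ≤ x} with hRdef
  have hR : (Set.univ : Set M).Definable₁ L R := by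
    refine DefinablePred.and (n := 1)
      (.and (.not (.le_const hle p 0)) (.not (.const_le hle q 0))) (.ex (.and (hG.rel 0 1) ?_))
    refine .all (.all (.imp (.rel hle 1 2) (.imp (hG.rel 1 0) (.imp ?_ (.rel hle 3 0)))))
    exact .and (.not (.le_const hle p 0)) (.not (.const_le hle q 0))
  simp only [not_le] at hRdef
  have hcoinitial : ∀ c, p < c → c < q → ∃ r ∈ R, r ≤ c := by
    intro c hpc hcq
    obtain ⟨d, hd⟩ := hsub ⟨hpc, hcq⟩
    obtain ⟨m, ⟨⟨e, hed, hem⟩, hm⟩, hmin⟩ := Set.exists_min_image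
      ({x | ∃ e ≤ d, G e x} ∩ Set.Ioo p q) id ((hfin d).inter_of_left _)
      ⟨c, ⟨d, le_rfl, hd⟩, hpc, hcq⟩
    refine ⟨m, ?_, hmin c ⟨⟨d, le_rfl, hd⟩, hpc, hcq⟩⟩
    rw [hRdef]
    exact ⟨hm, e, hem, fun e' x he' hx hxI => hmin x ⟨⟨e', he'.trans hed, hx⟩, hxI⟩⟩
  have hRI : R ⊆ Set.Ioo p q := by
    rw [hRdef]
    exact fun x hx => hx.1
  rcases (halmost R hR ⟨q, fun x hx => (hRI hx).2.le⟩
    ⟨p, fun x hx => (hRI hx).1.le⟩).finite_or_exists_Ioo_subset with h | ⟨s, t, hst, hstR⟩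
  · obtain ⟨c, hpc, hcq⟩ := exists_between hpq
    obtain ⟨r₀, hr₀, -⟩ := hcoinitial c hpc hcq
    obtain ⟨r, hr, hmin⟩ := Set.exists_min_image R id h ⟨r₀, hr₀⟩
    obtain ⟨c', hpc', hc'r⟩ := exists_between (hRI hr).1
    obtain ⟨r', hr', hle'⟩ := hcoinitial c' hpc' (hc'r.trans (hRI hr).2)
    exact ((hmin r' hr').trans hle').not_gt hc'r
  · obtain ⟨c, hsc, hct⟩ := exists_between hst
    obtain ⟨d, hd⟩ := hsub (hRI (hstR ⟨hsc, hct⟩))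
    refine Set.Ioo_infinite hct ((hfin d).subset fun x hx => ?_)
    have hxR := hstR ⟨hsc.trans hx.1, hx.2⟩
    rw [hRdef] at hxR
    obtain ⟨-, d', hd', hmin⟩ := hxR
    refine ⟨d', le_of_not_ge fun h => ?_, hd'⟩
    exact (hmin d c h hd (hRI (hstR ⟨hsc, hct⟩))).not_gt hx.1

variable {D : Set M} {a b : M}

/-- A definable partial function from `(a, b)` to a definable discrete set is bounded above. -/
theorem IsAlmostOMinimal.bddAbove_of_unary (halmost : IsAlmostOMinimal L M)
    (hle : DefinablePred L fun v : Fin 2 → M => v 0 ≤ v 1)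
    (hDdef : (Set.univ : Set M).Definable₁ L D) (hDdisc : IsDiscreteSet D) {S : M → M → Prop}
    (hS : DefinablePred L fun v : Fin 2 → M => S (v 0) (v 1))
    (hmem : ∀ d t, S d t → d ∈ D ∧ t ∈ Set.Ioo a b)
    (hfun : ∀ d d' t, S d t → S d' t → d = d') : BddAbove {d | ∃ t, S d t} := by
  have : Nonempty M := ⟨a⟩
  rcases Set.eq_empty_or_nonempty {d | ∃ t, S d t} with h | ⟨e₀, he₀⟩
  · simp [h]
  set E : Set M := {d | e₀ ≤ d ∧ ∃ t, S d t}
  suffices hE : E.Finite by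
    obtain ⟨c, hc⟩ := hE.bddAbove
    refine ⟨c, fun d hd => ?_⟩
    rcases le_total e₀ d with h | h
    · exact hc ⟨h, hd⟩
    · exact h.trans (hc ⟨le_rfl, he₀⟩)
  -- `G d x` says that `d ∈ E` and that `x` is the infimum of the fibre over `d`
  set G : M → M → Prop := fun d x => (e₀ ≤ d ∧ ∃ t, S d t) ∧ (∀ t, S d t → x ≤ t) ∧
    ∀ y, (∀ t, S d t → y ≤ t) → y ≤ x
  have hGdef : DefinablePred L fun v : Fin 2 → M => G (v 0) (v 1) :=
    .and (.and (.const_le hle e₀ 0) (.ex (hS.rel 1 0)))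
      (.and (.all (.imp (hS.rel 1 0) (.rel hle 2 0)))
        (.all (.imp (.all (.imp (hS.rel 2 0) (.rel hle 1 0))) (.rel hle 0 2))))
  have hGunique : ∀ d x x', G d x → G d x' → x = x' := fun d x x' h h' =>
    le_antisymm (h'.2.2 x h.2.1) (h.2.2 x' h'.2.1)
  have hfibre : ∀ d, IsFinUnionPointsIntervals {t | S d t} := fun d => by
    have hdef : DefinablePred L fun v : Fin 1 → M => ∃ x, x = d ∧ S x (v 0) :=
      .ex (.and (.eq_const d 0) (hS.rel 0 1))
    simp only [exists_eq_left] at hdef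
    exact halmost _ hdef
      ⟨b, fun t ht => (hmem d t ht).2.2.le⟩ ⟨a, fun t ht => (hmem d t ht).2.1.le⟩
  have hGexists : ∀ d ∈ E, ∃ x, G d x := fun d hd => by
    obtain ⟨x, hx⟩ := (hfibre d).exists_isGLB hd.2 ⟨a, fun t ht => (hmem d t ht).2.1.le⟩
    exact ⟨x, hd, fun t ht => hx.1 ht, fun y hy => hx.2 hy⟩
  have hGmem : ∀ d x, G d x → a ≤ x ∧ x ≤ b := fun d x h => by
    obtain ⟨⟨-, t, ht⟩, hx, hx'⟩ := h
    exact ⟨hx' a fun s hs => (hmem d s hs).2.1.le, (hx t ht).trans (hmem d t ht).2.2.le⟩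
  have hEfin : ∀ d, {e | e ≤ d ∧ e ∈ E}.Finite := fun d =>
    (halmost.finite_inter_Icc hle hDdef hDdisc e₀ d).subset fun e ⟨hed, he, t, ht⟩ =>
      ⟨(hmem e t ht).1, he, hed⟩
  choose! g hg using hGexists
  have himage : (g '' E).Finite := by
    refine (halmost.finite_of_finite_initial hle hGdef (fun d => ?_)
      ⟨b, fun x ⟨e, h⟩ => (hGmem e x h).2⟩ ⟨a, fun x ⟨e, h⟩ => (hGmem e x h).1⟩).subset ?_
    · refine ((hEfin d).image g).subset ?_
      rintro x ⟨e, hed, h⟩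
      exact ⟨e, ⟨hed, h.1⟩, hGunique _ _ _ (hg e h.1) h⟩
    · rintro _ ⟨e, he, rfl⟩
      exact ⟨e, hg e he⟩
  refine himage.of_finite_fibers g fun x _ => ?_
  -- at most one fibre contains `x`, and at most one accumulates at `x` from the right
  have hright : ∀ e ∈ E, g e = x → ¬ S e x → ∃ y, x < y ∧ ∀ z, x < z → z < y → S e z := by
    intro e he hex hSx
    obtain ⟨y, hy, h | h⟩ := (hfibre e).exists_Ioo_right x
    · exact ⟨y, hy, h⟩
    · have hG := hg e he
      rw [hex] at hG
      refine absurd (hG.2.2 y fun t ht => ?_) hy.not_ge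
      refine le_of_not_gt fun hty => h t (lt_of_le_of_ne (hG.2.1 t ht) ?_) hty ht
      rintro rfl
      exact hSx ht
  have hin : {e ∈ E | g e = x ∧ S e x}.Subsingleton := fun e he e' he' =>
    hfun _ _ _ he.2.2 he'.2.2
  have hout : {e ∈ E | g e = x ∧ ¬ S e x}.Subsingleton := by
    intro e he e' he'
    obtain ⟨y, hy, h⟩ := hright e he.1 he.2.1 he.2.2
    obtain ⟨y', hy', h'⟩ := hright e' he'.1 he'.2.1 he'.2.2
    obtain ⟨z, hxz, hz⟩ := exists_between (lt_min hy hy')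
    rw [lt_min_iff] at hz
    exact hfun e e' z (h z hxz hz.1) (h' z hxz hz.2)
  refine (hin.finite.union hout.finite).subset fun e he => ?_
  by_cases h : S e x
  · exact .inl ⟨he.1, he.2, h⟩
  · exact .inr ⟨he.1, he.2, h⟩

/-- A definable partial function from `(a, b)ⁿ` to a definable discrete set is bounded above. -/
theorem IsAlmostOMinimal.bddAbove_of_discrete (halmost : IsAlmostOMinimal L M)
    (hle : DefinablePred L fun v : Fin 2 → M => v 0 ≤ v 1)
    (hDdef : (Set.univ : Set M).Definable₁ L D) (hDdisc : IsDiscreteSet D) {n : ℕ}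
    {S : M → (Fin n → M) → Prop}
    (hS : DefinablePred L fun w : Fin (n + 1) → M => S (w 0) fun i => w i.succ)
    (hmem : ∀ d y, S d y → d ∈ D ∧ ∀ k, y k ∈ Set.Ioo a b)
    (hfun : ∀ d d' y, S d y → S d' y → d = d') : BddAbove {d | ∃ y, S d y} := by
  induction n with
  | zero =>
    have : Nonempty M := ⟨a⟩
    refine Set.Finite.bddAbove (Set.Subsingleton.finite ?_)
    rintro d ⟨y, h⟩ d' ⟨y', h'⟩
    exact hfun d d' y h (Subsingleton.elim y' y ▸ h')
  | succ n ih =>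
    have hcons : DefinablePred L
        fun w : Fin (n + 2) → M => S (w 1) (Fin.cons (w 0) fun i => w i.succ.succ) := by
      convert! hS.comp (Fin.cons 1 (Fin.cons 0 fun i => i.succ.succ) : Fin (n + 2) → Fin (n + 2))
        using 3 with w
      ext i
      cases i using Fin.cases <;> simp
    have hcons' : DefinablePred L
        fun w : Fin (n + 3) → M => S (w 1) (Fin.cons (w 0) fun i => w i.succ.succ.succ) :=
      hcons.comp (Fin.cons 0 (Fin.cons 1 fun i => i.succ.succ.succ) : Fin (n + 2) → Fin (n + 3))
    -- induct on the function sending `y` to the maximum of the function over the line at `y`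
    obtain ⟨c, hc⟩ := ih
      (S := fun d y => (∃ t, S d (Fin.cons t y)) ∧ ∀ e t, S e (Fin.cons t y) → e ≤ d)
      (.and (.ex hcons) (.all (.all (.imp hcons' (.rel hle 1 2)))))
      (fun d y ⟨⟨t, ht⟩, _⟩ => ⟨(hmem _ _ ht).1, fun k => by
        simpa using (hmem _ _ ht).2 k.succ⟩)
      (fun d d' y ⟨⟨t, ht⟩, h⟩ ⟨⟨t', ht'⟩, h'⟩ => le_antisymm (h' _ _ ht) (h _ _ ht'))
    refine ⟨c, fun d ⟨y, hy⟩ => ?_⟩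
    obtain ⟨t, y, rfl⟩ : ∃ t z, y = Fin.cons t z := ⟨y 0, Fin.tail y, (Fin.cons_self_tail y).symm⟩
    have hline : DefinablePred L fun v : Fin 2 → M => S (v 0) (Fin.cons (v 1) y) := by
      refine DefinablePred.specialize (R := fun u y => S (u 0) (Fin.cons (u 1) y)) ?_ y
      convert! hS using 3 with w
      ext i
      cases i using Fin.cases <;> simp
    obtain ⟨u, hu⟩ := halmost.bddAbove_of_unary (a := a) (b := b)
      (S := fun d t => S d (Fin.cons t y)) hle hDdef hDdisc hline
      (fun d t h => ⟨(hmem _ _ h).1, by simpa using (hmem _ _ h).2 0⟩)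
      (fun d d' t h h' => hfun _ _ _ h h')
    obtain ⟨m, ⟨hdm, s, hs⟩, hmax⟩ := Set.exists_max_image
      {e | d ≤ e ∧ ∃ t, S e (Fin.cons t y)} id
      ((halmost.finite_inter_Icc hle hDdef hDdisc d u).subset fun e ⟨hde, s, hs⟩ =>
        ⟨(hmem _ _ hs).1, hde, hu ⟨s, hs⟩⟩) ⟨d, le_rfl, t, hy⟩
    refine hdm.trans (hc ⟨y, ⟨s, hs⟩, fun e t' he => ?_⟩)
    rcases le_total d e with h | h
    · exact hmax e ⟨h, t', he⟩
    · exact h.trans hdm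

theorem IsAlmostOMinimal.bddAbove_image (halmost : IsAlmostOMinimal L M)
    (hle : DefinablePred L fun v : Fin 2 → M => v 0 ≤ v 1)
    (hDdef : (Set.univ : Set M).Definable₁ L D) (hDdisc : IsDiscreteSet D) {n : ℕ}
    {F : (Fin n → M) → M} (hFD : ∀ y : Fin n → M, (∀ k, y k ∈ Set.Ioo a b) → F y ∈ D)
    (hFdef : DefinablePred L fun v : Fin (n + 1) → M =>
      (∀ k : Fin n, v k.castSucc ∈ Set.Ioo a b) ∧ v (Fin.last n) = F fun k => v k.castSucc) :
    BddAbove (F '' {y : Fin n → M | ∀ k, y k ∈ Set.Ioo a b}) := by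
  have hS : DefinablePred L fun w : Fin (n + 1) → M =>
      (∀ k : Fin n, w k.succ ∈ Set.Ioo a b) ∧ w 0 = F fun k => w k.succ := by
    convert! hFdef.comp (Fin.snoc Fin.succ 0 : Fin (n + 1) → Fin (n + 1)) using 3 with w <;> simp
  refine (halmost.bddAbove_of_discrete (a := a) (b := b)
    (S := fun d y => (∀ k, y k ∈ Set.Ioo a b) ∧ d = F y) hle hDdef hDdisc hS
    (fun d y h => ⟨h.2 ▸ hFD y h.1, h.1⟩) (fun d d' y h h' => h.2.trans h'.2.symm)).mono ?_
  rintro _ ⟨y, hy, rfl⟩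
  exact ⟨y, hy, rfl⟩

end AlmostOMinimal

/-! ### Reversing the order -/

section OrderDual

variable {M : Type w} [LinearOrder M]

theorem IsDiscreteSet.dual {D : Set M} (hD : IsDiscreteSet D) :
    IsDiscreteSet (OrderDual.ofDual ⁻¹' D) := fun x hx => by
  obtain ⟨l, r, hl, hr, h⟩ := hD (OrderDual.ofDual x) hx
  exact ⟨OrderDual.toDual r, OrderDual.toDual l, hr, hl, fun z hz hz' => h z hz ⟨hz'.2, hz'.1⟩⟩

theorem IsFinUnionPointsIntervals.dual {s : Set M} (hs : IsFinUnionPointsIntervals s) :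
    IsFinUnionPointsIntervals (OrderDual.ofDual ⁻¹' s) := by
  obtain ⟨F, n, J, hJ, rfl⟩ := hs
  refine ⟨F.map OrderDual.toDual.toEmbedding, n, fun k => OrderDual.ofDual ⁻¹' J k,
    fun k => ?_, ?_⟩
  · beta_reduce
    rcases hJ k with ⟨c, d, h⟩ | ⟨c, h⟩ | ⟨d, h⟩ | h
    · exact .inl ⟨OrderDual.toDual d, OrderDual.toDual c, by rw [h]; ext x; exact and_comm⟩
    · exact .inr (.inr (.inl ⟨OrderDual.toDual c, by rw [h]; rfl⟩))
    · exact .inr (.inl ⟨OrderDual.toDual d, by rw [h]; rfl⟩)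
    · exact .inr (.inr (.inr (by rw [h]; rfl)))
  · ext x
    simp

end OrderDual

/-- Let `M` be an almost o-minimal structure expanding a dense linear
order without endpoints, `D ⊆ M` a definable discrete set, `a < b` in `M` and `n ≥ 1`.
Then for every definable function `F : (a,b)ⁿ → D` (a function whose values on
`{y | ∀ k, y k ∈ (a,b)}` lie in `D` and whose graph, with output as the last coordinate,
is a definable subset of `M^(n+1)`), the range of `F` on `(a,b)ⁿ` is bounded above and
below in `M`. -/
theorem range_bounded_of_definable_function_into_discrete_almost
    {L : FirstOrder.Language.{u, v}} [L.IsOrdered] {M : Type w}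
    [LinearOrder M] [L.Structure M] [L.OrderedStructure M]
    [DenselyOrdered M] [NoMinOrder M] [NoMaxOrder M]
    (halmost : IsAlmostOMinimal L M)
    (D : Set M) (hDdef : (Set.univ : Set M).Definable₁ L D) (hDdisc : IsDiscreteSet D)
    (a b : M) (hab : a < b) (n : ℕ) (hn : 1 ≤ n)
    (F : (Fin n → M) → M)
    (hFD : ∀ y : Fin n → M, (∀ k, y k ∈ Set.Ioo a b) → F y ∈ D)
    (hFdef : (Set.univ : Set M).Definable L
      {v : Fin (n + 1) → M | (∀ k : Fin n, v k.castSucc ∈ Set.Ioo a b) ∧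
        v (Fin.last n) = F fun k => v k.castSucc}) :
    BddAbove (F '' {y : Fin n → M | ∀ k, y k ∈ Set.Ioo a b}) ∧
      BddBelow (F '' {y : Fin n → M | ∀ k, y k ∈ Set.Ioo a b}) := by
  have hle : DefinablePred L fun v : Fin 2 → M => v 0 ≤ v 1 := by
    have h : (∅ : Set M).Definable L {v : Fin 2 → M | v 0 ≤ v 1} := by
      rw [Set.empty_definable_iff]
      refine ⟨FirstOrder.Language.Term.le (n := 0) (FirstOrder.Language.Term.var (.inl 0))
        (FirstOrder.Language.Term.var (.inl 1)), ?_⟩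
      ext v
      simp [FirstOrder.Language.Formula.Realize, FirstOrder.Language.Term.realize_le]
    exact h.mono (Set.empty_subset _)
  refine ⟨halmost.bddAbove_image hle hDdef hDdisc hFD hFdef, ?_⟩
  let _ : L.Structure Mᵒᵈ := ‹L.Structure M›
  have halmost' : IsAlmostOMinimal L Mᵒᵈ := fun s hs habove hbelow =>
    (halmost (OrderDual.toDual ⁻¹' s) hs hbelow habove).dual
  have hFdef' : DefinablePred L fun v : Fin (n + 1) → M =>
      (∀ k : Fin n, v k.castSucc < b ∧ a < v k.castSucc) ∧
        v (Fin.last n) = F fun k => v k.castSucc := by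
    simpa only [DefinablePred, Set.mem_Ioo, and_comm] using hFdef
  have hdual := halmost'.bddAbove_image (a := OrderDual.toDual b) (b := OrderDual.toDual a)
    (D := OrderDual.ofDual ⁻¹' D) (n := n) (F := F) (hle.rel 1 0) hDdef hDdisc.dual
    (fun y hy => hFD y fun k => (hy k).symm) hFdef'
  exact BddBelow.mono (Set.image_mono fun y hy k => (hy k).symm) hdual
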